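/- arXiv:2304.02442 — 2 statements merged into one kernel-verified Lean document; each statement's English description precedes it below -/
import Mathlib

section
/- Let κ ∈ (0,1], q ∈ [1+κ, ∞), and p be such that 1/p + 1/q = 1. Set K_q = 10·max{1, (q−1)^{(1+κ)/2}} and φ_p(x) = (κ/(1+κ))‖x‖_p^{(1+κ)/κ}. Then φ_p is a differentiable convex function on ℝ^d and is (K_q^{−1/κ}, (1+κ)/κ)-uniformly convex with respect to the ℓ_p-norm, i.e., for all x, y ∈ ℝ^d: φ_p(y) − φ_p(x) − ⟨∇φ_p(x), y − x⟩ ≥ (κ/(1+κ)) K_q^{−1/κ} ‖x − y‖_p^{(1+κ)/κ}. -/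
noncomputable section

/-- Midpoint form of convexity of `t ↦ t ^ m` on the nonnegative reals. -/
lemma half_add_rpow_le {u v m : ℝ} (hu : 0 ≤ u) (hv : 0 ≤ v) (hm : 1 ≤ m) :
    ((u + v) / 2) ^ m ≤ (u ^ m + v ^ m) / 2 := by
  have h := (convexOn_rpow hm).2 (Set.mem_Ici.2 hu) (Set.mem_Ici.2 hv)
    (by norm_num : (0 : ℝ) ≤ 1 / 2) (by norm_num : (0 : ℝ) ≤ 1 / 2) (by norm_num)
  simp only [smul_eq_mul] at h
  calc ((u + v) / 2) ^ m = (1 / 2 * u + 1 / 2 * v) ^ m := by ring_nf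
    _ ≤ _ := h
    _ = _ := by ring

/-- Superadditivity of `t ↦ t ^ m` on the nonnegative reals, for `1 ≤ m`. -/
lemma rpow_add_rpow_le_add_rpow {u v m : ℝ} (hu : 0 ≤ u) (hv : 0 ≤ v) (hm : 1 ≤ m) :
    u ^ m + v ^ m ≤ (u + v) ^ m := by
  lift u to NNReal using hu
  lift v to NNReal using hv
  exact_mod_cast NNReal.add_rpow_le_rpow_add u v hm

/-- The second-derivative estimate behind the two-point inequality below. -/
lemma two_le_rpow_add_rpow {t s : ℝ} (ht : 0 < t) (ht1 : t < 1) (hs : s ≤ 0) :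
    2 ≤ (1 + t) ^ s + (1 - t) ^ s := by
  have h1 : 0 < (1 + t) ^ s := Real.rpow_pos_of_pos (by linarith) _
  have h2 : 0 < (1 - t) ^ s := Real.rpow_pos_of_pos (by linarith) _
  have h3 : 1 ≤ (1 + t) ^ s * (1 - t) ^ s := by
    rw [← Real.mul_rpow (by linarith) (by linarith)]
    exact Real.one_le_rpow_of_pos_of_le_one_of_nonpos (by nlinarith) (by nlinarith) hs
  nlinarith [sq_nonneg ((1 + t) ^ s - (1 - t) ^ s)]

lemma two_mul_mul_le_rpow_sub_rpow {t s : ℝ} (hs : 0 < s) (hs1 : s ≤ 1) (ht : 0 ≤ t)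
    (ht1 : t ≤ 1) : 2 * s * t ≤ (1 + t) ^ s - (1 - t) ^ s := by
  have hd : ∀ x ∈ Set.Ioo (0 : ℝ) 1, HasDerivAt
      (fun x : ℝ => (1 + x) ^ s - (1 - x) ^ s - 2 * s * x)
      (1 * s * (1 + x) ^ (s - 1) - (-1) * s * (1 - x) ^ (s - 1) - 2 * s * 1) x := by
    intro x hx
    exact ((((hasDerivAt_id x).const_add 1).rpow_const (Or.inl (by simp; linarith [hx.1]))).sub
      (((hasDerivAt_id x).const_sub 1).rpow_const (Or.inl (by simp; linarith [hx.2])))).sub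
      ((hasDerivAt_id x).const_mul _)
  have hmono : MonotoneOn (fun x : ℝ => (1 + x) ^ s - (1 - x) ^ s - 2 * s * x)
      (Set.Icc 0 1) := by
    refine monotoneOn_of_deriv_nonneg (convex_Icc 0 1) ?_ ?_ ?_
    · refine Continuous.continuousOn ?_
      exact ((((continuous_const.add continuous_id).rpow_const fun _ => Or.inr hs.le).sub
        ((continuous_const.sub continuous_id).rpow_const fun _ => Or.inr hs.le)).sub
        (continuous_const.mul continuous_id))
    · rw [interior_Icc]
      exact fun x hx => (hd x hx).differentiableAt.differentiableWithinAt
    · rw [interior_Icc]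
      intro x hx
      rw [(hd x hx).deriv]
      nlinarith [two_le_rpow_add_rpow hx.1 hx.2 (by linarith : s - 1 ≤ 0)]
  have h := hmono ⟨le_rfl, zero_le_one⟩ ⟨ht, ht1⟩ ht
  simp only [add_zero, sub_zero, Real.one_rpow, mul_zero, sub_self] at h
  linarith

lemma one_add_mul_sq_le_rpow_add_rpow {t p : ℝ} (hp : 1 < p) (hp2 : p ≤ 2) (ht : 0 ≤ t)
    (ht1 : t ≤ 1) : 1 + p * (p - 1) / 2 * t ^ 2 ≤ ((1 + t) ^ p + (1 - t) ^ p) / 2 := by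
  have hd : ∀ x : ℝ, HasDerivAt
      (fun x : ℝ => (1 + x) ^ p + (1 - x) ^ p - p * (p - 1) * x ^ 2)
      (1 * p * (1 + x) ^ (p - 1) + (-1) * p * (1 - x) ^ (p - 1)
        - p * (p - 1) * (2 * x)) x := by
    intro x
    have h2 : HasDerivAt (fun x : ℝ => x ^ 2) (2 * x) x := by simpa using hasDerivAt_pow 2 x
    exact ((((hasDerivAt_id x).const_add 1).rpow_const (Or.inr hp.le)).add
      (((hasDerivAt_id x).const_sub 1).rpow_const (Or.inr hp.le))).sub
      (h2.const_mul _)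
  have hmono : MonotoneOn (fun x : ℝ => (1 + x) ^ p + (1 - x) ^ p - p * (p - 1) * x ^ 2)
      (Set.Icc 0 1) := by
    refine monotoneOn_of_deriv_nonneg (convex_Icc 0 1) ?_ ?_ ?_
    · exact fun x _ => (hd x).continuousAt.continuousWithinAt
    · exact fun x _ => (hd x).differentiableAt.differentiableWithinAt
    · rw [interior_Icc]
      intro x hx
      rw [(hd x).deriv]
      nlinarith [two_mul_mul_le_rpow_sub_rpow (by linarith : 0 < p - 1) (by linarith)
        hx.1.le hx.2.le]
  have h := hmono ⟨le_rfl, zero_le_one⟩ ⟨ht, ht1⟩ ht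
  norm_num at h
  linarith

/-- The two-point inequality for `1 < p ≤ 2`, with nonnegative ordered arguments. -/
lemma two_point_of_le {a b p : ℝ} (hp : 1 < p) (hp2 : p ≤ 2) (hb : 0 ≤ b) (hba : b ≤ a) :
    (a ^ 2 + (p - 1) * b ^ 2) ^ (p / 2) ≤ ((a + b) ^ p + (a - b) ^ p) / 2 := by
  rcases (hb.trans hba).eq_or_lt with rfl | ha
  · obtain rfl : b = 0 := le_antisymm hba hb
    simp [Real.zero_rpow (by linarith : p / 2 ≠ 0), Real.zero_rpow (by linarith : p ≠ 0)]
  obtain ⟨t, rfl⟩ : ∃ t, b = a * t := ⟨b / a, by field_simp⟩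
  have ht : 0 ≤ t := by by_contra! h; nlinarith
  have ht1 : t ≤ 1 := by by_contra! h; nlinarith
  have hap : (a ^ 2) ^ (p / 2) = a ^ p := by
    rw [← Real.rpow_natCast_mul ha.le]; congr 1; push_cast; ring
  have h0 : 0 ≤ (p - 1) * t ^ 2 := mul_nonneg (by linarith) (sq_nonneg t)
  rw [show a ^ 2 + (p - 1) * (a * t) ^ 2 = a ^ 2 * (1 + (p - 1) * t ^ 2) by ring,
    show a + a * t = a * (1 + t) by ring, show a - a * t = a * (1 - t) by ring,
    Real.mul_rpow (sq_nonneg a) (by linarith), Real.mul_rpow ha.le (by linarith),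
    Real.mul_rpow ha.le (by linarith), hap, ← mul_add, mul_div_assoc]
  refine mul_le_mul_of_nonneg_left ?_ (Real.rpow_nonneg ha.le _)
  have h1 := rpow_one_add_le_one_add_mul_self (by linarith : -1 ≤ (p - 1) * t ^ 2)
    (by linarith : 0 ≤ p / 2) (by linarith)
  have h2 := one_add_mul_sq_le_rpow_add_rpow hp hp2 ht ht1
  linarith

lemma abs_add_rpow_add_abs_sub_rpow (a b p : ℝ) :
    |a + b| ^ p + |a - b| ^ p = (|a| + |b|) ^ p + |(|a| - |b|)| ^ p := by
  rcases le_total 0 a with ha | ha <;> rcases le_total 0 b with hb | hb <;>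
    simp only [abs_of_nonneg, abs_of_nonpos, ha, hb]
  · rw [abs_of_nonneg (add_nonneg ha hb)]
  · rw [add_comm, abs_of_nonneg (by linarith : 0 ≤ a - b)]; congr 2; congr 1; ring
  · rw [add_comm, abs_of_nonpos (by linarith : a - b ≤ 0)]; congr 2
    · ring
    · rw [← abs_neg]; congr 1; ring
  · rw [abs_of_nonpos (by linarith : a + b ≤ 0)]; congr 2
    · ring
    · rw [← abs_neg]; congr 1; ring

/-- The two-point inequality for `1 < p ≤ 2`. -/
lemma two_point_of_le_two {p : ℝ} (hp : 1 < p) (hp2 : p ≤ 2) (a b : ℝ) :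
    (a ^ 2 + (p - 1) * b ^ 2) ^ (p / 2) ≤ (|a + b| ^ p + |a - b| ^ p) / 2 := by
  rw [abs_add_rpow_add_abs_sub_rpow, ← sq_abs a, ← sq_abs b]
  rcases le_total |b| |a| with h | h
  · rw [abs_of_nonneg (sub_nonneg.2 h)]
    exact two_point_of_le hp hp2 (abs_nonneg b) h
  · rw [abs_of_nonpos (sub_nonpos.2 h), add_comm |a|, neg_sub]
    refine le_trans (Real.rpow_le_rpow ?_ ?_ (by linarith))
      (two_point_of_le hp hp2 (abs_nonneg a) h)
    · exact add_nonneg (sq_nonneg _) (mul_nonneg (by linarith) (sq_nonneg _))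
    · nlinarith [pow_le_pow_left₀ (abs_nonneg a) h 2]

lemma sq_rpow_half (a p : ℝ) : (a ^ 2) ^ (p / 2) = |a| ^ p := by
  rw [← sq_abs, ← Real.rpow_natCast_mul (abs_nonneg a)]; congr 1; push_cast; ring

/-- The pointwise Clarkson inequality for `2 ≤ p`. -/
lemma two_point_of_two_le {p : ℝ} (hp : 2 ≤ p) (a b : ℝ) :
    |a| ^ p + |b| ^ p ≤ (|a + b| ^ p + |a - b| ^ p) / 2 := by
  have hm : 1 ≤ p / 2 := by linarith
  simp only [← sq_rpow_half]
  calc _ ≤ (a ^ 2 + b ^ 2) ^ (p / 2) :=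
        rpow_add_rpow_le_add_rpow (sq_nonneg a) (sq_nonneg b) hm
    _ = (((a + b) ^ 2 + (a - b) ^ 2) / 2) ^ (p / 2) := by congr 1; ring
    _ ≤ _ := half_add_rpow_le (sq_nonneg _) (sq_nonneg _) hm

/-- The reverse Minkowski inequality for exponents `0 < s ≤ 1`. -/
lemma add_le_Lp_of_le_one {ι : Type*} (A : Finset ι) {s : ℝ} (hs : 0 < s) (hs1 : s ≤ 1)
    {u v : ι → ℝ} (hu : ∀ i, 0 ≤ u i) (hv : ∀ i, 0 ≤ v i) :
    ((∑ i ∈ A, u i ^ s) ^ (1 / s) + (∑ i ∈ A, v i ^ s) ^ (1 / s)) ^ s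
      ≤ ∑ i ∈ A, (u i + v i) ^ s := by
  have hX0 : 0 ≤ ∑ i ∈ A, u i ^ s := Finset.sum_nonneg fun i _ => Real.rpow_nonneg (hu i) _
  have hY0 : 0 ≤ ∑ i ∈ A, v i ^ s := Finset.sum_nonneg fun i _ => Real.rpow_nonneg (hv i) _
  have hinv : ∀ z : ℝ, 0 ≤ z → (z ^ (1 / s)) ^ s = z := fun z hz => by
    rw [← Real.rpow_mul hz, one_div_mul_cancel hs.ne', Real.rpow_one]
  have h1s : 1 / s ≠ 0 := (one_div_pos.2 hs).ne'
  rcases hX0.eq_or_lt with hX | hX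
  · rw [← hX, Real.zero_rpow h1s, zero_add, hinv _ hY0]
    exact Finset.sum_le_sum fun i _ =>
      Real.rpow_le_rpow (hv i) (le_add_of_nonneg_left (hu i)) hs.le
  rcases hY0.eq_or_lt with hY | hY
  · rw [← hY, Real.zero_rpow h1s, add_zero, hinv _ hX0]
    exact Finset.sum_le_sum fun i _ =>
      Real.rpow_le_rpow (hu i) (le_add_of_nonneg_right (hv i)) hs.le
  have hXs := hinv _ hX0
  have hYs := hinv _ hY0
  have hXpos := Real.rpow_pos_of_pos hX (1 / s)
  have hYpos := Real.rpow_pos_of_pos hY (1 / s)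
  set X := (∑ i ∈ A, u i ^ s) ^ (1 / s)
  set Y := (∑ i ∈ A, v i ^ s) ^ (1 / s)
  have hXY : 0 < X + Y := add_pos hXpos hYpos
  have hpt : ∀ i ∈ A, (X + Y) ^ s * (X / (X + Y) * (u i ^ s / X ^ s)
      + Y / (X + Y) * (v i ^ s / Y ^ s)) ≤ (u i + v i) ^ s := by
    intro i _
    have h := (Real.concaveOn_rpow hs.le hs1).2
      (Set.mem_Ici.2 (div_nonneg (hu i) hXpos.le)) (Set.mem_Ici.2 (div_nonneg (hv i) hYpos.le))
      (div_nonneg hXpos.le hXY.le) (div_nonneg hYpos.le hXY.le)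
      (by rw [← add_div, div_self hXY.ne'])
    simp only [smul_eq_mul] at h
    rw [Real.div_rpow (hu i) hXpos.le, Real.div_rpow (hv i) hYpos.le] at h
    refine (mul_le_mul_of_nonneg_left h (Real.rpow_nonneg hXY.le s)).trans_eq ?_
    rw [← Real.mul_rpow hXY.le (by have := hu i; have := hv i; positivity)]
    congr 1
    field_simp
  refine le_trans (le_of_eq ?_) (Finset.sum_le_sum hpt)
  rw [← Finset.mul_sum, Finset.sum_add_distrib, ← Finset.mul_sum, ← Finset.mul_sum,
    ← Finset.sum_div, ← Finset.sum_div, ← hXs, ← hYs,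
    div_self (Real.rpow_pos_of_pos hXpos s).ne', div_self (Real.rpow_pos_of_pos hYpos s).ne',
    mul_one, mul_one, ← add_div, div_self hXY.ne', mul_one]

/-- Clarkson-type inequality for the `r`-th power of the `p`-norm, `p ≤ 2 ≤ r`. -/
lemma clarkson_of_le_two {ι : Type*} [Fintype ι] {p r : ℝ} (hp : 1 < p) (hp2 : p ≤ 2)
    (hr : 2 ≤ r) (a b : ι → ℝ) :
    (∑ i, |a i| ^ p) ^ (r / p) + (p - 1) ^ (r / 2) * (∑ i, |b i| ^ p) ^ (r / p) ≤
      ((∑ i, |a i + b i| ^ p) ^ (r / p) + (∑ i, |a i - b i| ^ p) ^ (r / p)) / 2 := by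
  have hp0 : 0 < p := by linarith
  have hσ : 0 ≤ p - 1 := by linarith
  have hS : ∀ f : ι → ℝ, 0 ≤ ∑ i, |f i| ^ p :=
    fun f => Finset.sum_nonneg fun i _ => Real.rpow_nonneg (abs_nonneg _) _
  have hm : 1 ≤ r / p := (one_le_div hp0).2 (by linarith)
  have hkey : ∀ z : ℝ, 0 ≤ z → (z ^ (1 / (p / 2))) ^ (r / 2) = z ^ (r / p) := fun z hz => by
    rw [← Real.rpow_mul hz]; congr 1; field_simp
  have hmink := add_le_Lp_of_le_one Finset.univ (by linarith : 0 < p / 2) (by linarith)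
    (u := fun i => a i ^ 2) (v := fun i => (p - 1) * b i ^ 2) (fun i => sq_nonneg _)
    (fun i => mul_nonneg hσ (sq_nonneg _))
  have hA : ∑ i, (a i ^ 2) ^ (p / 2) = ∑ i, |a i| ^ p := by simp only [sq_rpow_half]
  have hB : ∑ i, ((p - 1) * b i ^ 2) ^ (p / 2) = (p - 1) ^ (p / 2) * ∑ i, |b i| ^ p := by
    rw [Finset.mul_sum]
    exact Finset.sum_congr rfl fun i _ => by rw [Real.mul_rpow hσ (sq_nonneg _), sq_rpow_half]
  have hmean : ∑ i, (a i ^ 2 + (p - 1) * b i ^ 2) ^ (p / 2) ≤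
      (∑ i, |a i + b i| ^ p + ∑ i, |a i - b i| ^ p) / 2 := by
    rw [← Finset.sum_add_distrib, Finset.sum_div]
    exact Finset.sum_le_sum fun i _ => two_point_of_le_two hp hp2 (a i) (b i)
  rw [hA, hB] at hmink
  have hB0 : 0 ≤ (p - 1) ^ (p / 2) * ∑ i, |b i| ^ p := mul_nonneg (Real.rpow_nonneg hσ _) (hS b)
  have hX0 := Real.rpow_nonneg (hS a) (1 / (p / 2))
  have hY0 := Real.rpow_nonneg hB0 (1 / (p / 2))
  calc _ = ((∑ i, |a i| ^ p) ^ (1 / (p / 2))) ^ (r / 2)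
        + (((p - 1) ^ (p / 2) * ∑ i, |b i| ^ p) ^ (1 / (p / 2))) ^ (r / 2) := by
        rw [hkey _ (hS a), hkey _ hB0, Real.mul_rpow (Real.rpow_nonneg hσ _) (hS b),
          ← Real.rpow_mul hσ]
        congr 3; field_simp
    _ ≤ _ := rpow_add_rpow_le_add_rpow hX0 hY0 (by linarith)
    _ = (((∑ i, |a i| ^ p) ^ (1 / (p / 2)) + ((p - 1) ^ (p / 2) * ∑ i, |b i| ^ p)
        ^ (1 / (p / 2))) ^ (p / 2)) ^ (r / p) := by
        rw [← Real.rpow_mul (add_nonneg hX0 hY0)]; congr 1; field_simp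
    _ ≤ ((∑ i, |a i + b i| ^ p + ∑ i, |a i - b i| ^ p) / 2) ^ (r / p) :=
        Real.rpow_le_rpow (Real.rpow_nonneg (add_nonneg hX0 hY0) _) (hmink.trans hmean)
          (by linarith)
    _ ≤ _ := half_add_rpow_le (hS fun i => a i + b i) (hS fun i => a i - b i) hm

/-- Clarkson's inequality for the `r`-th power of the `p`-norm, `2 ≤ p ≤ r`. -/
lemma clarkson_of_two_le {ι : Type*} [Fintype ι] {p r : ℝ} (hp : 2 ≤ p) (hr : p ≤ r)
    (a b : ι → ℝ) :
    (∑ i, |a i| ^ p) ^ (r / p) + (∑ i, |b i| ^ p) ^ (r / p) ≤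
      ((∑ i, |a i + b i| ^ p) ^ (r / p) + (∑ i, |a i - b i| ^ p) ^ (r / p)) / 2 := by
  have hp0 : 0 < p := by linarith
  have hS : ∀ f : ι → ℝ, 0 ≤ ∑ i, |f i| ^ p :=
    fun f => Finset.sum_nonneg fun i _ => Real.rpow_nonneg (abs_nonneg _) _
  have hm : 1 ≤ r / p := (one_le_div hp0).2 hr
  have hmean : ∑ i, |a i| ^ p + ∑ i, |b i| ^ p ≤
      (∑ i, |a i + b i| ^ p + ∑ i, |a i - b i| ^ p) / 2 := by
    rw [← Finset.sum_add_distrib, ← Finset.sum_add_distrib, Finset.sum_div]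
    exact Finset.sum_le_sum fun i _ => two_point_of_two_le hp (a i) (b i)
  calc _ ≤ _ := rpow_add_rpow_le_add_rpow (hS a) (hS b) hm
    _ ≤ _ := Real.rpow_le_rpow (add_nonneg (hS a) (hS b)) hmean (by linarith)
    _ ≤ _ := half_add_rpow_le (hS fun i => a i + b i) (hS fun i => a i - b i) hm

/-- First-order characterization of convexity. -/
lemma ConvexOn.fderiv_sub_le {E : Type*} [NormedAddCommGroup E] [NormedSpace ℝ E] {f : E → ℝ}
    (hf : ConvexOn ℝ Set.univ f) {x : E} (hd : DifferentiableAt ℝ f x) (y : E) :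
    fderiv ℝ f x (y - x) ≤ f y - f x := by
  have hline : ConvexOn ℝ Set.univ (f ∘ AffineMap.lineMap (k := ℝ) x y) :=
    hf.comp_affineMap (AffineMap.lineMap (k := ℝ) x y)
  have hderiv : HasDerivAt (f ∘ AffineMap.lineMap (k := ℝ) x y) (fderiv ℝ f x (y - x)) 0 := by
    refine HasFDerivAt.comp_hasDerivAt (0 : ℝ) ?_ AffineMap.hasDerivAt_lineMap
    simpa using hd.hasFDerivAt
  have h := hline.le_slope_of_hasDerivAt (Set.mem_univ 0) (Set.mem_univ 1) zero_lt_one hderiv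
  simpa [slope_def_field] using h

lemma differentiable_sum_abs_rpow {ι : Type*} [Fintype ι] {p : ℝ} (hp : 1 < p) :
    Differentiable ℝ fun x : ι → ℝ => ∑ i, |x i| ^ p := by
  refine Differentiable.fun_sum fun i _ => ?_
  have h : Differentiable ℝ fun t : ℝ => |t| ^ p :=
    fun t => (hasDerivAt_abs_rpow t hp).differentiableAt
  exact h.comp (differentiable_apply i)

lemma convexOn_sum_abs_rpow {ι : Type*} [Fintype ι] {p : ℝ} (hp : 1 ≤ p) :
    ConvexOn ℝ Set.univ fun x : ι → ℝ => ∑ i, |x i| ^ p := by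
  refine ⟨convex_univ, fun x _ y _ α β hα hβ hαβ => ?_⟩
  simp only [smul_eq_mul, Pi.add_apply, Pi.smul_apply, Finset.mul_sum]
  rw [← Finset.sum_add_distrib]
  refine Finset.sum_le_sum fun i _ => ?_
  have h := (convexOn_rpow hp).2 (Set.mem_Ici.2 (abs_nonneg (x i)))
    (Set.mem_Ici.2 (abs_nonneg (y i))) hα hβ hαβ
  refine le_trans (Real.rpow_le_rpow (abs_nonneg _) ?_ (by linarith)) h
  refine (abs_add_le _ _).trans_eq ?_
  rw [abs_mul, abs_mul, abs_of_nonneg hα, abs_of_nonneg hβ, smul_eq_mul, smul_eq_mul]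

lemma ConvexOn.rpow_of_nonneg {E : Type*} [AddCommGroup E] [Module ℝ E] {f : E → ℝ} {m : ℝ}
    {s : Set E} (hf : ConvexOn ℝ s f) (hf0 : ∀ x, 0 ≤ f x) (hm : 1 ≤ m) :
    ConvexOn ℝ s fun x => f x ^ m := by
  refine ⟨hf.1, fun x hx y hy α β hα hβ hαβ => ?_⟩
  exact (Real.rpow_le_rpow (hf0 _) (hf.2 hx hy hα hβ hαβ) (by linarith)).trans
    ((convexOn_rpow hm).2 (Set.mem_Ici.2 (hf0 x)) (Set.mem_Ici.2 (hf0 y)) hα hβ hαβ)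

/-- A midpoint convexity gap of size `g` yields a Bregman divergence of size `2 * g`. -/
lemma ConvexOn.two_mul_le_bregman {E : Type*} [NormedAddCommGroup E] [NormedSpace ℝ E]
    {f : E → ℝ} (hf : ConvexOn ℝ Set.univ f) {x y : E} (hd : DifferentiableAt ℝ f x) {g : ℝ}
    (hg : f ((1 / 2 : ℝ) • (x + y)) + g ≤ (f x + f y) / 2) :
    2 * g ≤ f y - f x - fderiv ℝ f x (y - x) := by
  have h := hf.fderiv_sub_le hd ((1 / 2 : ℝ) • (x + y))
  rw [show (1 / 2 : ℝ) • (x + y) - x = (1 / 2 : ℝ) • (y - x) by module, map_smul,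
    smul_eq_mul] at h
  linarith

/-- Uniform convexity of a multiple of the `r`-th power of the `p`-norm, from a Clarkson-type
inequality with constant `τ`. -/
lemma bregman_Lp_rpow_ge {ι : Type*} [Fintype ι] {p r c τ : ℝ} (hp : 1 < p) (hc : 0 ≤ c)
    (hcl : ∀ a b : ι → ℝ,
      (∑ i, |a i| ^ p) ^ (r / p) + τ * (∑ i, |b i| ^ p) ^ (r / p) ≤
        ((∑ i, |a i + b i| ^ p) ^ (r / p) + (∑ i, |a i - b i| ^ p) ^ (r / p)) / 2)
    {f : (ι → ℝ) → ℝ} (hf : ∀ x, f x = c * (∑ i, |x i| ^ p) ^ (r / p))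
    (hconv : ConvexOn ℝ Set.univ f) (hd : Differentiable ℝ f) (x y : ι → ℝ) :
    c * (2 ^ (1 - r) * τ) * (∑ i, |x i - y i| ^ p) ^ (r / p) ≤
      f y - f x - fderiv ℝ f x (y - x) := by
  have hp0 : 0 < p := by linarith
  have hscale : (∑ i, |(x i - y i) / 2| ^ p) ^ (r / p) =
      2 ^ (-r) * (∑ i, |x i - y i| ^ p) ^ (r / p) := by
    have h1 : ∑ i, |(x i - y i) / 2| ^ p = 2 ^ (-p) * ∑ i, |x i - y i| ^ p := by
      rw [Finset.mul_sum]
      refine Finset.sum_congr rfl fun i _ => ?_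
      rw [abs_div, Real.div_rpow (abs_nonneg _) (abs_nonneg _), Real.rpow_neg zero_le_two,
        abs_two, div_eq_inv_mul]
    rw [h1, Real.mul_rpow (by positivity)
      (Finset.sum_nonneg fun i _ => Real.rpow_nonneg (abs_nonneg _) _),
      ← Real.rpow_mul zero_le_two]
    congr 2; field_simp
  have h := hcl (fun i => (x i + y i) / 2) (fun i => (x i - y i) / 2)
  rw [hscale] at h
  have e1 : ∀ i, (x i + y i) / 2 + (x i - y i) / 2 = x i := fun i => by ring
  have e2 : ∀ i, (x i + y i) / 2 - (x i - y i) / 2 = y i := fun i => by ring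
  simp only [e1, e2] at h
  have hgap := hconv.two_mul_le_bregman (x := x) (y := y) (hd x)
    (g := c * (τ * (2 ^ (-r) * (∑ i, |x i - y i| ^ p) ^ (r / p)))) (by
      rw [hf, hf x, hf y]
      simp only [Pi.smul_apply, Pi.add_apply, smul_eq_mul, one_div_mul_eq_div]
      linarith [mul_le_mul_of_nonneg_left h hc])
  refine le_trans (le_of_eq ?_) hgap
  rw [sub_eq_add_neg, Real.rpow_add two_pos, Real.rpow_one]
  ring

theorem statement3 {d : ℕ} (κ p q : ℝ) (hκ : κ ∈ Set.Ioc (0 : ℝ) 1)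
    (hq : q ∈ Set.Ici (1 + κ)) (hpq : 1/p + 1/q = 1)
    (Kq : ℝ) (hKq : Kq = 10 * max 1 ((q - 1) ^ ((1 + κ)/2)))
    (φp : (Fin d → ℝ) → ℝ)
    (hφp : ∀ x, φp x = κ/(1+κ) * ((∑ i, |x i| ^ p) ^ (1/p)) ^ ((1+κ)/κ)) :
    Differentiable ℝ φp ∧ ConvexOn ℝ Set.univ φp ∧
      ∀ x y : Fin d → ℝ,
        (κ/(1+κ)) * Kq ^ (-(1/κ)) * ((∑ i, |x i - y i| ^ p) ^ (1/p)) ^ ((1+κ)/κ) ≤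
          φp y - φp x - fderiv ℝ φp x (y - x) := by
  obtain ⟨hκ0, hκ1⟩ := hκ
  have hq1 : 0 < q - 1 := by have := Set.mem_Ici.1 hq; linarith
  have hqκ : κ ≤ q - 1 := by have := Set.mem_Ici.1 hq; linarith
  have hp_eq : p = q / (q - 1) := by
    have hp0 : p ≠ 0 := by
      rintro rfl
      have : q = 1 := by simpa using hpq
      linarith
    have : q ≠ 0 := by linarith
    field_simp at hpq ⊢
    linarith
  have hpσ : p - 1 = (q - 1)⁻¹ := by rw [hp_eq]; field_simp; ring
  have hp : 1 < p := by have := inv_pos.2 hq1; linarith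
  obtain ⟨r, hr⟩ : ∃ r, r = (1 + κ) / κ := ⟨_, rfl⟩
  have hrκ : 1 / κ = r - 1 := by rw [hr]; field_simp; ring
  have hpr : p ≤ r := by
    have h1 : (q - 1)⁻¹ ≤ 1 / κ := by rw [← one_div]; exact one_div_le_one_div_of_le hκ0 hqκ
    linarith
  have hr2 : 2 ≤ r := by
    have : 1 ≤ 1 / κ := (one_le_div hκ0).2 hκ1
    linarith
  have hm : 1 ≤ r / p := (one_le_div (by linarith)).2 hpr
  have hc : 0 ≤ κ / (1 + κ) := by positivity
  have hS : ∀ f : Fin d → ℝ, 0 ≤ ∑ i, |f i| ^ p :=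
    fun f => Finset.sum_nonneg fun i _ => Real.rpow_nonneg (abs_nonneg _) _
  have hpow : ∀ z : ℝ, 0 ≤ z → (z ^ (1 / p)) ^ ((1 + κ) / κ) = z ^ (r / p) := fun z hz => by
    rw [← Real.rpow_mul hz, ← hr]; congr 1; ring
  have hφ : ∀ x, φp x = κ / (1 + κ) * (∑ i, |x i| ^ p) ^ (r / p) := fun x => by
    rw [hφp, hpow _ (hS x)]
  have hd : Differentiable ℝ φp := by
    rw [funext hφ]
    exact ((differentiable_sum_abs_rpow hp).rpow_const fun _ => Or.inr hm).const_mul _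
  have hconv : ConvexOn ℝ Set.univ φp := by
    rw [funext hφ]
    exact ((convexOn_sum_abs_rpow hp.le).rpow_of_nonneg hS hm).smul hc
  refine ⟨hd, hconv, fun x y => ?_⟩
  rw [hpow _ (hS fun i => x i - y i), hrκ]
  have hr1 : -(r - 1) ≤ 0 := by linarith
  have hten : (10 : ℝ) ^ (-(r - 1)) ≤ 2 ^ (1 - r) := by
    rw [← neg_sub r 1]
    exact Real.rpow_le_rpow_of_nonpos two_pos (by norm_num) hr1
  have hmul : Kq ^ (-(r - 1)) =
      10 ^ (-(r - 1)) * (max 1 ((q - 1) ^ ((1 + κ) / 2))) ^ (-(r - 1)) := by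
    rw [hKq, Real.mul_rpow (by norm_num) (by positivity)]
  have hfinal : ∀ τ : ℝ, 0 ≤ τ → (max 1 ((q - 1) ^ ((1 + κ) / 2))) ^ (-(r - 1)) ≤ τ →
      (∀ a b : Fin d → ℝ,
        (∑ i, |a i| ^ p) ^ (r / p) + τ * (∑ i, |b i| ^ p) ^ (r / p) ≤
        ((∑ i, |a i + b i| ^ p) ^ (r / p) + (∑ i, |a i - b i| ^ p) ^ (r / p)) / 2) →
      κ / (1 + κ) * Kq ^ (-(r - 1)) * (∑ i, |x i - y i| ^ p) ^ (r / p) ≤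
        φp y - φp x - fderiv ℝ φp x (y - x) := by
    intro τ hτ0 hτ hcl
    refine le_trans ?_ (bregman_Lp_rpow_ge hp hc hcl hφ hconv hd x y)
    refine mul_le_mul_of_nonneg_right (mul_le_mul_of_nonneg_left ?_ hc)
      (Real.rpow_nonneg (hS fun i => x i - y i) _)
    rw [hmul]
    exact mul_le_mul hten hτ (by positivity) (by positivity)
  rcases le_total p 2 with hp2 | hp2
  · refine hfinal ((p - 1) ^ (r / 2)) (Real.rpow_nonneg (by linarith) _) ?_
      (clarkson_of_le_two hp hp2 hr2)
    refine (Real.rpow_le_rpow_of_nonpos (Real.rpow_pos_of_pos hq1 _) (le_max_right _ _)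
      hr1).trans_eq ?_
    rw [hpσ, ← Real.rpow_mul hq1.le, Real.inv_rpow hq1.le, ← Real.rpow_neg hq1.le]
    congr 1
    rw [← hrκ, hr]
    field_simp
  · refine hfinal 1 zero_le_one (Real.rpow_le_one_of_one_le_of_nonpos (le_max_left _ _) hr1) ?_
    intro a b
    rw [one_mul]
    exact clarkson_of_two_le hp2 hpr a b
end
end

section
/- Let d ≥ 3, q ∈ [2, ∞), κ ∈ (0,1], and let e be a random vector uniformly distributed on the Euclidean unit sphere S₂^d = {x ∈ ℝ^d : ‖x‖₂ = 1}. Then E_e[‖e‖_q^{2(1+κ)}] ≤ a_q^{2(1+κ)}, where a_q = d^{1/q − 1/2} min{√(32 ln d − 8), √(2q − 1)}. -/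
open MeasureTheory

noncomputable section

/-- A probability measure on `ℝ^d` is the uniform distribution on the Euclidean unit
sphere if it is concentrated on the sphere and invariant under all linear isometries
(i.e., it is the normalized rotation-invariant surface measure). -/
def IsUniformOnSphere {d : ℕ} (μ : Measure (EuclideanSpace ℝ (Fin d))) : Prop :=
  IsProbabilityMeasure μ ∧ (∀ᵐ x ∂μ, ‖x‖ = 1) ∧
    ∀ R : EuclideanSpace ℝ (Fin d) ≃ₗᵢ[ℝ] EuclideanSpace ℝ (Fin d), μ.map ⇑R = μ

/-- Two real polynomial functions, one given by its monomials and the other equal to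
`c * (1 + t ^ 2) ^ n`, have the same quadratic coefficient if they agree everywhere. -/
lemma quadratic_coeff_of_eq_one_add_sq_pow {N n : ℕ} (hN : 2 < N) (a : ℕ → ℝ) (c : ℝ)
    (h : ∀ t : ℝ, ∑ m ∈ Finset.range N, a m * t ^ m = c * (1 + t ^ 2) ^ n) :
    a 2 = c * n := by
  have hP : ∑ m ∈ Finset.range N, Polynomial.C (a m) * Polynomial.X ^ m =
      Polynomial.C c * Polynomial.expand ℝ 2 ((1 + Polynomial.X) ^ n) := by
    apply Polynomial.funext
    intro t
    simpa [Polynomial.eval_finsetSum] using h t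
  have h2 := congrArg (fun P => Polynomial.coeff P 2) hP
  have h3 : (Polynomial.expand ℝ 2 ((1 + Polynomial.X) ^ n)).coeff 2 = n := by
    have := Polynomial.coeff_expand_mul (R := ℝ) (p := 2) (by norm_num)
      ((1 + Polynomial.X) ^ n) 1
    simpa [Polynomial.coeff_one_add_X_pow] using this
  simp only [Polynomial.finsetSum_coeff,
    Polynomial.coeff_C_mul, h3] at h2
  simpa [hN] using h2

/-- The inductive step for bounding `(2 * m - 1)‼` by `m ^ m`. -/
lemma two_mul_add_one_mul_pow_self_le (m : ℕ) :
    (2 * m + 1 : ℝ) * (m : ℝ) ^ m ≤ (m + 1 : ℝ) ^ (m + 1) := by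
  rcases Nat.eq_zero_or_pos m with rfl | hm
  · simp
  have hm' : (0 : ℝ) < m := by exact_mod_cast hm
  have hb := one_add_mul_le_pow (a := (1 / m : ℝ)) (by linarith [one_div_pos.2 hm']) m
  have h2 : (2 : ℝ) * (m : ℝ) ^ m ≤ (m + 1 : ℝ) ^ m := by
    have h3 : (m + 1 : ℝ) ^ m = (1 + 1 / m : ℝ) ^ m * (m : ℝ) ^ m := by
      rw [← mul_pow]; congr 1; field_simp
    rw [h3]
    gcongr
    have : (m : ℝ) * (1 / m) = 1 := by field_simp
    linarith
  have : (0 : ℝ) ≤ (m : ℝ) ^ m := by positivity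
  rw [pow_succ]
  nlinarith

lemma sum_rpow_le_rpow_sum {ι : Type*} (s : Finset ι) (f : ι → ℝ) (hf : ∀ i, 0 ≤ f i)
    {r : ℝ} (hr : 1 ≤ r) : ∑ i ∈ s, f i ^ r ≤ (∑ i ∈ s, f i) ^ r := by
  have key : ∀ y : ℝ, 0 ≤ y → y ^ r = y * y ^ (r - 1) := by
    intro y hy
    rcases hy.eq_or_lt with rfl | hy
    · rw [zero_mul, Real.zero_rpow (by linarith)]
    · rw [← Real.rpow_one_add' hy.le (by linarith)]; congr 1; ring
  rw [key _ (Finset.sum_nonneg fun i _ => hf i), Finset.sum_mul]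
  refine Finset.sum_le_sum fun i hi => ?_
  rw [key _ (hf i)]
  exact mul_le_mul_of_nonneg_left (Real.rpow_le_rpow (hf i)
    (Finset.single_le_sum (fun j _ => hf j) hi) (by linarith)) (hf i)

/-- Comparison of an `ℓ_q`-norm with an `ℓ_p`-norm of larger exponent. -/
lemma lp_norm_le_card_rpow_mul {d : ℕ} (hd : 0 < d) (x : Fin d → ℝ) {q p : ℝ} (hq : 0 < q)
    (hqp : q ≤ p) :
    (∑ i, |x i| ^ q) ^ (1 / q) ≤
      (d : ℝ) ^ (1 / q - 1 / p) * (∑ i, |x i| ^ p) ^ (1 / p) := by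
  have hp : 0 < p := hq.trans_le hqp
  have hd' : (0 : ℝ) < d := by exact_mod_cast hd
  have h := Real.rpow_sum_le_const_mul_sum_rpow (Finset.univ) (fun i => |x i| ^ q)
    ((one_le_div hq).2 hqp)
  have hpow : ∀ i, (|x i| ^ q) ^ (p / q) = |x i| ^ p := fun i => by
    rw [← Real.rpow_mul (abs_nonneg _)]; congr 1; field_simp
  have habs : ∀ i, |(|x i| ^ q)| = |x i| ^ q := fun i => abs_of_nonneg (by positivity)
  simp only [habs, hpow, Finset.card_univ, Fintype.card_fin] at h
  have hS : 0 ≤ ∑ i, |x i| ^ q := Finset.sum_nonneg fun i _ => by positivity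
  have hT : 0 ≤ ∑ i, |x i| ^ p := Finset.sum_nonneg fun i _ => by positivity
  have h' := Real.rpow_le_rpow (by positivity) h (one_div_nonneg.2 hp.le)
  rw [← Real.rpow_mul hS, Real.mul_rpow (by positivity) hT, ← Real.rpow_mul hd'.le] at h'
  convert h' using 2
  · field_simp
  · congr 1; field_simp

/-- The `ℓ_p`-norms are antitone in the exponent. -/
lemma lp_norm_antitone_exponent {d : ℕ} (x : Fin d → ℝ) {p q : ℝ} (hp : 0 < p) (hpq : p ≤ q) :
    (∑ i, |x i| ^ q) ^ (1 / q) ≤ (∑ i, |x i| ^ p) ^ (1 / p) := by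
  have hq : 0 < q := hp.trans_le hpq
  have h := sum_rpow_le_rpow_sum Finset.univ (fun i => |x i| ^ p) (fun i => by positivity)
    ((one_le_div hp).2 hpq)
  have hpow : ∀ i, (|x i| ^ p) ^ (q / p) = |x i| ^ q := fun i => by
    rw [← Real.rpow_mul (abs_nonneg _)]; congr 1; field_simp
  simp only [hpow] at h
  have hS : 0 ≤ ∑ i, |x i| ^ q := Finset.sum_nonneg fun i _ => by positivity
  have hT : 0 ≤ ∑ i, |x i| ^ p := Finset.sum_nonneg fun i _ => by positivity
  have h' := Real.rpow_le_rpow hS h (one_div_nonneg.2 hq.le)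
  rw [← Real.rpow_mul hT] at h'
  convert h' using 2
  field_simp

namespace IsUniformOnSphere

variable {d : ℕ} {μ : Measure (EuclideanSpace ℝ (Fin d))}

lemma ae_abs_coord_le_one (h : IsUniformOnSphere μ) : ∀ᵐ x ∂μ, ∀ i, |x i| ≤ 1 := by
  filter_upwards [h.2.1] with x hx i
  have := PiLp.norm_apply_le x i
  rwa [hx] at this

/-- Moments of the pairing with a fixed vector depend only on the length of the vector. -/
lemma integral_inner_pow_eq_of_norm_eq (h : IsUniformOnSphere μ) (n : ℕ)
    {u v : EuclideanSpace ℝ (Fin d)} (huv : ‖u‖ = ‖v‖) :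
    ∫ x, (inner ℝ u x) ^ n ∂μ = ∫ x, (inner ℝ v x) ^ n ∂μ := by
  set R := (Submodule.span ℝ {u - v})ᗮ.reflection with hR
  have hRu : R u = v := Submodule.reflection_sub huv
  calc ∫ x, (inner ℝ u x) ^ n ∂μ
      = ∫ x, (inner ℝ v (R x)) ^ n ∂μ := by
        simp_rw [← hRu, LinearIsometryEquiv.inner_map_map]
    _ = ∫ x, (inner ℝ v x) ^ n ∂(μ.map R) :=
        (integral_map (f := fun x => (inner ℝ v x) ^ n)
          R.continuous.measurable.aemeasurable (by fun_prop)).symm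
    _ = ∫ x, (inner ℝ v x) ^ n ∂μ := by rw [h.2.2 R]

lemma integrable_coord_pow_mul_coord_pow (h : IsUniformOnSphere μ) (i j : Fin d) (a b : ℕ) :
    Integrable (fun x => x i ^ a * x j ^ b) μ := by
  have := h.1
  refine Integrable.of_bound (C := 1) (by fun_prop) ?_
  filter_upwards [h.ae_abs_coord_le_one] with x hx
  rw [Real.norm_eq_abs, abs_mul, abs_pow, abs_pow]
  exact mul_le_one₀ (pow_le_one₀ (abs_nonneg _) (hx i)) (by positivity)
    (pow_le_one₀ (abs_nonneg _) (hx j))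

lemma integrable_coord_pow (h : IsUniformOnSphere μ) (i : Fin d) (a : ℕ) :
    Integrable (fun x => x i ^ a) μ := by
  simpa using h.integrable_coord_pow_mul_coord_pow i i a 0

lemma integral_coord_add_mul_coord_pow (h : IsUniformOnSphere μ) {i j : Fin d} (hij : i ≠ j)
    (k : ℕ) (t : ℝ) :
    ∫ x, (t * x j + x i) ^ (2 * k) ∂μ = (1 + t ^ 2) ^ k * ∫ x, x i ^ (2 * k) ∂μ := by
  set v : EuclideanSpace ℝ (Fin d) := EuclideanSpace.single i 1 + EuclideanSpace.single j t
  set c : ℝ := √(1 + t ^ 2)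
  have hc : c ^ 2 = 1 + t ^ 2 := Real.sq_sqrt (by positivity)
  have hinner : ∀ x, inner ℝ v x = t * x j + x i := fun x => by
    simp only [v, inner_add_left, EuclideanSpace.inner_single_left]
    simp; ring
  have hv : ‖v‖ = ‖EuclideanSpace.single (𝕜 := ℝ) i c‖ := by
    have hc0 : 0 ≤ c := Real.sqrt_nonneg _
    rw [PiLp.norm_single, Real.norm_of_nonneg hc0,
      ← sq_eq_sq₀ (norm_nonneg _) hc0, hc, ← real_inner_self_eq_norm_sq, hinner]
    simp [v, hij, hij.symm]; ring
  have := h.integral_inner_pow_eq_of_norm_eq (2 * k) hv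
  simp only [hinner, EuclideanSpace.inner_single_left, mul_pow] at this
  rw [this, integral_const_mul]
  simp [pow_mul, hc]

lemma two_mul_add_one_mul_integral_coord_pow_mul_sq (h : IsUniformOnSphere μ) {i j : Fin d}
    (hij : i ≠ j) (m : ℕ) :
    (2 * m + 1) * ∫ x, x i ^ (2 * m) * x j ^ 2 ∂μ = ∫ x, x i ^ (2 * (m + 1)) ∂μ := by
  have hcoef := quadratic_coeff_of_eq_one_add_sq_pow (N := 2 * (m + 1) + 1) (n := m + 1)
    (by omega)
    (fun l => (Nat.choose (2 * (m + 1)) l : ℝ) *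
      ∫ x, x i ^ (2 * (m + 1) - l) * x j ^ l ∂μ)
    (∫ x, x i ^ (2 * (m + 1)) ∂μ) (fun t => by
      rw [mul_comm (∫ x, x i ^ (2 * (m + 1)) ∂μ),
        ← h.integral_coord_add_mul_coord_pow hij (m + 1) t]
      simp_rw [add_pow]
      rw [integral_finsetSum]
      · refine Finset.sum_congr rfl fun l _ => ?_
        rw [mul_right_comm, ← integral_const_mul]
        congr 1
        ext x
        ring
      · intro l _
        refine ((h.integrable_coord_pow_mul_coord_pow i j (2 * (m + 1) - l) l).const_mul
          (t ^ l * (Nat.choose (2 * (m + 1)) l : ℝ))).congr (Filter.Eventually.of_forall ?_)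
        intro x
        simp only
        ring)
  have hchoose : (Nat.choose (2 * (m + 1)) 2 : ℝ) = (m + 1) * (2 * m + 1) := by
    rw [Nat.cast_choose_two]; push_cast; ring
  have hsub : 2 * (m + 1) - 2 = 2 * m := by omega
  simp only [hchoose, hsub] at hcoef
  have hm : (m + 1 : ℝ) ≠ 0 := by positivity
  apply mul_left_cancel₀ hm
  push_cast at hcoef
  linarith

/-- The recursion between consecutive even moments of a coordinate. -/
lemma add_mul_integral_coord_pow (h : IsUniformOnSphere μ) (i : Fin d) (m : ℕ) :
    (d + 2 * m) * ∫ x, x i ^ (2 * (m + 1)) ∂μ = (2 * m + 1) * ∫ x, x i ^ (2 * m) ∂μ := by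
  have hsum : ∑ j, ∫ x, x i ^ (2 * m) * x j ^ 2 ∂μ = ∫ x, x i ^ (2 * m) ∂μ := by
    rw [← integral_finsetSum _ fun j _ => h.integrable_coord_pow_mul_coord_pow i j _ _]
    refine integral_congr_ae ?_
    filter_upwards [h.2.1] with x hx
    rw [← Finset.mul_sum, ← EuclideanSpace.real_norm_sq_eq, hx]
    ring
  rw [← Finset.add_sum_erase _ _ (Finset.mem_univ i)] at hsum
  have hsame : ∫ x, x i ^ (2 * m) * x i ^ 2 ∂μ = ∫ x, x i ^ (2 * (m + 1)) ∂μ := by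
    congr 1
    ext x
    ring
  have hothers : (2 * m + 1 : ℝ) * ∑ j ∈ Finset.univ.erase i, ∫ x, x i ^ (2 * m) * x j ^ 2 ∂μ
      = (d - 1) * ∫ x, x i ^ (2 * (m + 1)) ∂μ := by
    rw [Finset.mul_sum, Finset.sum_congr rfl fun j hj =>
      h.two_mul_add_one_mul_integral_coord_pow_mul_sq (Finset.ne_of_mem_erase hj).symm m,
      Finset.sum_const, Finset.card_erase_of_mem (Finset.mem_univ i), Finset.card_univ,
      Fintype.card_fin, nsmul_eq_mul, Nat.cast_pred i.pos]
  rw [hsame] at hsum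
  linear_combination (2 * m + 1) * hsum - hothers

lemma integral_coord_pow_le (h : IsUniformOnSphere μ) (i : Fin d) (k : ℕ) :
    ∫ x, x i ^ (2 * k) ∂μ ≤ (k / d : ℝ) ^ k := by
  have := h.1
  have hd : (0 : ℝ) < d := by exact_mod_cast i.pos
  induction k with
  | zero => simp
  | succ m ih =>
    have hrec := h.add_mul_integral_coord_pow i m
    have hnonneg : 0 ≤ ∫ x, x i ^ (2 * (m + 1)) ∂μ :=
      integral_nonneg fun x => (even_two_mul _).pow_nonneg _
    have hm : (0 : ℝ) ≤ m * ∫ x, x i ^ (2 * (m + 1)) ∂μ := by positivity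
    have hpow := two_mul_add_one_mul_pow_self_le m
    have hstep : d * ∫ x, x i ^ (2 * (m + 1)) ∂μ ≤ (2 * m + 1) * (m / d : ℝ) ^ m := by
      have := mul_le_mul_of_nonneg_left ih (by positivity : (0 : ℝ) ≤ 2 * m + 1)
      linarith
    refine le_of_mul_le_mul_left (hstep.trans ?_) hd
    push_cast
    rw [div_pow, div_pow, pow_succ (d : ℝ), ← mul_div_assoc, ← mul_div_assoc,
      mul_comm (d : ℝ) (_ ^ _), mul_div_mul_right _ _ hd.ne']
    gcongr

/-- If the `ℓ_q`-norm is dominated by `C` times the `ℓ_{2k}`-norm, then its moments of order at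
most `2 * k` are controlled by `C`. -/
lemma integral_lp_norm_rpow_le (h : IsUniformOnSphere μ) (hd : 0 < d) {q s C : ℝ} {k : ℕ}
    (hC : 0 ≤ C) (hs : 0 < s) (hsk : s ≤ 2 * k)
    (hq : ∀ x : EuclideanSpace ℝ (Fin d), (∑ i, |x i| ^ q) ^ (1 / q) ≤
      C * (∑ i, |x i| ^ (2 * k : ℝ)) ^ (1 / (2 * k : ℝ))) :
    ∫ x, ((∑ i, |x i| ^ q) ^ (1 / q)) ^ s ∂μ ≤
      (C * ((d : ℝ) ^ (1 / (2 * k : ℝ) - 1 / 2) * √k)) ^ s := by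
  have := h.1
  have hk : (0 : ℝ) < k := by linarith
  have hd' : (0 : ℝ) < d := by exact_mod_cast hd
  set p : ℝ := s / (2 * k)
  have hp0 : 0 ≤ p := by positivity
  have hp1 : p ≤ 1 := (div_le_one (by positivity)).2 hsk
  set S : EuclideanSpace ℝ (Fin d) → ℝ := fun x => ∑ i, x i ^ (2 * k)
  have hSeq : ∀ x : EuclideanSpace ℝ (Fin d), ∑ i, |x i| ^ (2 * k : ℝ) = S x := fun x => by
    refine Finset.sum_congr rfl fun i _ => ?_
    rw [← (even_two_mul k).pow_abs, ← Real.rpow_natCast, Nat.cast_mul, Nat.cast_two]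
  have hS0 : ∀ x, 0 ≤ S x := fun x =>
    Finset.sum_nonneg fun i _ => (even_two_mul k).pow_nonneg _
  have hSint : Integrable S μ := integrable_finsetSum _ fun i _ => h.integrable_coord_pow i _
  have hSp : Integrable (fun x => S x ^ p) μ := by
    refine (hSint.add (integrable_const 1)).mono' (by fun_prop) (Filter.Eventually.of_forall ?_)
    intro x
    rw [Real.norm_of_nonneg (Real.rpow_nonneg (hS0 x) _)]
    calc S x ^ p ≤ (S x + 1) ^ p := Real.rpow_le_rpow (hS0 x) (by linarith) hp0
      _ ≤ (S x + 1) ^ (1 : ℝ) := Real.rpow_le_rpow_of_exponent_le (by linarith [hS0 x]) hp1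
      _ = S x + 1 := Real.rpow_one _
  have hmean : ∫ x, S x ∂μ ≤ d * (k / d : ℝ) ^ k := by
    rw [integral_finsetSum _ fun i _ => h.integrable_coord_pow i _]
    calc ∑ i, ∫ x, x i ^ (2 * k) ∂μ ≤ ∑ _i : Fin d, (k / d : ℝ) ^ k :=
          Finset.sum_le_sum fun i _ => h.integral_coord_pow_le i k
      _ = d * (k / d : ℝ) ^ k := by simp
  have hjensen : ∫ x, S x ^ p ∂μ ≤ (∫ x, S x ∂μ) ^ p :=
    (Real.concaveOn_rpow hp0 hp1).le_map_integral
      (Real.continuous_rpow_const hp0).continuousOn isClosed_Ici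
      (Filter.Eventually.of_forall hS0) hSint hSp
  have hconst : (d * (k / d : ℝ) ^ k) ^ (1 / (2 * k : ℝ)) =
      (d : ℝ) ^ (1 / (2 * k : ℝ) - 1 / 2) * √k := by
    rw [Real.mul_rpow hd'.le (by positivity), ← Real.rpow_natCast,
      ← Real.rpow_mul (by positivity), Real.sqrt_eq_rpow, Real.rpow_sub hd',
      show (k : ℝ) * (1 / (2 * k)) = 1 / 2 by field_simp, Real.div_rpow hk.le hd'.le]
    ring
  have hpdef : p = 1 / (2 * k) * s := by simp only [p]; ring
  calc ∫ x, ((∑ i, |x i| ^ q) ^ (1 / q)) ^ s ∂μ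
      ≤ ∫ x, C ^ s * S x ^ p ∂μ := by
        refine integral_mono_of_nonneg (Filter.Eventually.of_forall fun x => by positivity)
          (hSp.const_mul _) (Filter.Eventually.of_forall fun x => ?_)
        have hx := hq x
        rw [hSeq] at hx
        have := Real.rpow_le_rpow (by positivity) hx hs.le
        rwa [Real.mul_rpow hC (Real.rpow_nonneg (hS0 x) _), ← Real.rpow_mul (hS0 x),
          ← hpdef] at this
    _ = C ^ s * ∫ x, S x ^ p ∂μ := integral_const_mul _ _
    _ ≤ C ^ s * (d * (k / d : ℝ) ^ k) ^ p := by
        gcongr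
        exact hjensen.trans (Real.rpow_le_rpow (integral_nonneg hS0) hmean hp0)
    _ = (C * ((d : ℝ) ^ (1 / (2 * k : ℝ) - 1 / 2) * √k)) ^ s := by
        rw [← hconst, Real.mul_rpow hC (by positivity), ← Real.rpow_mul (by positivity), hpdef]

end IsUniformOnSphere

theorem statement15 {d : ℕ} (hd : 3 ≤ d) (q κ : ℝ) (hq : 2 ≤ q)
    (hκ : κ ∈ Set.Ioc (0 : ℝ) 1)
    (μS : Measure (EuclideanSpace ℝ (Fin d))) (hμS : IsUniformOnSphere μS)
    (aq : ℝ)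
    (haq : aq = (d : ℝ) ^ (1/q - 1/2) *
      min (Real.sqrt (32 * Real.log d - 8)) (Real.sqrt (2*q - 1))) :
    ∫ e, ((∑ i, |e i| ^ q) ^ (1/q)) ^ (2 * (1 + κ)) ∂μS ≤ aq ^ (2 * (1 + κ)) := by
  obtain ⟨hκ0, hκ1⟩ := hκ
  have hd3 : (3 : ℝ) ≤ d := by exact_mod_cast hd
  have hd0 : (0 : ℝ) < d := by linarith
  have hd1 : (1 : ℝ) ≤ d := by linarith
  have hs : 0 < 2 * (1 + κ) := by linarith
  rcases le_total (2 * q - 1) (32 * Real.log d - 8) with hle | hle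
  · rw [min_eq_right (Real.sqrt_le_sqrt hle)] at haq
    set k : ℕ := max 2 ⌈q / 2⌉₊
    have hk2 : (2 : ℝ) ≤ k := by exact_mod_cast le_max_left _ _
    have hqk : q ≤ 2 * k := by
      have h1 : (⌈q / 2⌉₊ : ℝ) ≤ k := by exact_mod_cast le_max_right _ _
      linarith [Nat.le_ceil (q / 2)]
    have hkq : (k : ℝ) ≤ 2 * q - 1 := by
      simp only [k, Nat.cast_max]
      refine max_le (by norm_num; linarith) ?_
      linarith [Nat.ceil_lt_add_one (by linarith : 0 ≤ q / 2)]
    refine (hμS.integral_lp_norm_rpow_le (by omega) (by positivity) hs (by linarith)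
      fun x => lp_norm_le_card_rpow_mul (by omega) x (by linarith) hqk).trans ?_
    rw [haq, ← mul_assoc, ← Real.rpow_add hd0,
      show 1 / q - 1 / (2 * k : ℝ) + (1 / (2 * k : ℝ) - 1 / 2) = 1 / q - 1 / 2 by ring]
    gcongr
  · rw [min_eq_left (Real.sqrt_le_sqrt hle)] at haq
    set L := Real.log d
    have hL : 1 < L :=
      (Real.lt_log_iff_exp_lt hd0).2 ((Real.exp_one_lt_d9.trans (by norm_num)).trans_le hd3)
    set k : ℕ := ⌈L⌉₊
    have hLk : L ≤ k := Nat.le_ceil L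
    have hkL : (k : ℝ) < L + 1 := Nat.ceil_lt_add_one (by linarith)
    have hk2 : (2 : ℝ) ≤ k := by
      exact_mod_cast Nat.lt_ceil.2 (by simpa using hL : ((1 : ℕ) : ℝ) < L)
    refine (hμS.integral_lp_norm_rpow_le (k := k) (C := 1) (by omega) (by positivity) hs
      (by linarith) fun x => ?_).trans ?_
    · rw [one_mul]
      exact lp_norm_antitone_exponent x (by linarith) (by linarith)
    · rw [haq, one_mul]
      refine Real.rpow_le_rpow (by positivity) ?_ hs.le
      have hexp : (d : ℝ) ^ (1 / (2 * k : ℝ)) ≤ √3 := by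
        apply Real.le_sqrt_of_sq_le
        rw [← Real.rpow_natCast, ← Real.rpow_mul hd0.le, Real.rpow_def_of_pos hd0]
        calc Real.exp (L * (1 / (2 * k : ℝ) * (2 : ℕ))) ≤ Real.exp 1 := by
              apply Real.exp_le_exp.2
              rw [show L * (1 / (2 * k : ℝ) * (2 : ℕ)) = L / k by push_cast; field_simp]
              exact (div_le_one (by linarith)).2 hLk
          _ ≤ 3 := (Real.exp_one_lt_d9.trans (by norm_num)).le
      calc (d : ℝ) ^ (1 / (2 * k : ℝ) - 1 / 2) * √k
          = (d : ℝ) ^ (-(1 / 2) : ℝ) * ((d : ℝ) ^ (1 / (2 * k : ℝ)) * √k) := by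
            rw [← mul_assoc, ← Real.rpow_add hd0]; congr 2; ring
        _ ≤ (d : ℝ) ^ (1 / q - 1 / 2) * √(32 * L - 8) := by
            gcongr ?_ * ?_
            · refine Real.rpow_le_rpow_of_exponent_le hd1 ?_
              have : 0 ≤ 1 / q := by positivity
              linarith
            · calc (d : ℝ) ^ (1 / (2 * k : ℝ)) * √k ≤ √3 * √k := by gcongr
                _ = √(3 * k) := (Real.sqrt_mul (by norm_num) _).symm
                _ ≤ √(32 * L - 8) := Real.sqrt_le_sqrt (by linarith)
end
end
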